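/- arXiv:2003.03986 — 3 statements merged into one kernel-verified Lean document; each statement's English description precedes it below -/
import Mathlib

section
/- Let n ≥ 1, let A be the n×n real upper shift matrix and b = eₙ the last standard basis vector of ℝⁿ. For ω > 0, the bandwidth-parameterization gains k_i = (n! / ((n−i+1)!·(i−1)!)) · ω^{n−i+1} = C(n, i−1) ω^{n−i+1}, i = 1, …, n, yield the characteristic polynomial det(λI − (A − b k_BWᵀ)) = (λ + ω)ⁿ, i.e. all n closed-loop poles are placed at λ = −ω. -/
open Matrix Polynomial

/-- The `n × n` upper shift matrix: `A i j = 1` if `j = i + 1`, else `0`. -/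
noncomputable def shiftMat (n : ℕ) : Matrix (Fin n) (Fin n) ℝ :=
  Matrix.of fun i j => if (j : ℕ) = (i : ℕ) + 1 then 1 else 0

/-- The last standard basis vector `eₙ` of `ℝⁿ`. -/
noncomputable def lastVec (n : ℕ) : Fin n → ℝ :=
  fun i => if (i : ℕ) = n - 1 then 1 else 0

/-- Bandwidth-parameterization controller gains: the 1-based gain
`k_i = C(n, i-1) ω^(n-i+1)`; with 0-based index `i : Fin n` this is
`k i = C(n, i) ω^(n-i)`. -/
noncomputable def kBW (n : ℕ) (ω : ℝ) : Fin n → ℝ :=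
  fun i => (n.choose (i : ℕ)) * ω ^ (n - (i : ℕ))

/-- The characteristic polynomial of the bottom-row companion matrix of a monic polynomial `f`
is `f`. -/
theorem charpoly_companion_of_monic {K : Type*} [Field K] {f : K[X]} (hf : f.Monic) :
    (Matrix.of fun i j : Fin f.natDegree =>
      if (i : ℕ) + 1 = f.natDegree then -f.coeff j
      else if (j : ℕ) = i + 1 then 1 else 0).charpoly = f := by
  have hmin : minpoly K (AdjoinRoot.powerBasis' hf).gen = f := by
    rw [AdjoinRoot.powerBasis'_gen, AdjoinRoot.minpoly_root hf.ne_zero, hf.leadingCoeff]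
    simp
  have hchar := charpoly_leftMulMatrix (AdjoinRoot.powerBasis' hf)
  rw [PowerBasis.leftMulMatrix, PowerBasis.minpolyGen_eq, hmin, ← Matrix.charpoly_transpose]
    at hchar
  exact hchar

/-- Bandwidth parameterization places all closed-loop poles at `-ω`:
`det(λI - (A - b k_BWᵀ)) = (λ + ω)ⁿ`. -/
theorem charpoly_bandwidth_parameterization (n : ℕ) (hn : 1 ≤ n) (ω : ℝ) (hω : 0 < ω) :
    (shiftMat n - vecMulVec (lastVec n) (kBW n ω)).charpoly = (X + C ω) ^ n := by
  have hdeg : ((X + C ω) ^ n).natDegree = n := by simp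
  have hcomp := charpoly_companion_of_monic ((monic_X_add_C ω).pow n)
  simp only [coeff_X_add_C_pow] at hcomp
  generalize ((X + C ω) ^ n).natDegree = m at hdeg hcomp
  subst hdeg
  rw [← hcomp]
  congr 1
  ext i j
  have hi := i.isLt
  have hj := j.isLt
  simp only [shiftMat, lastVec, kBW, Matrix.sub_apply, vecMulVec_apply, Matrix.of_apply]
  by_cases h : (i : ℕ) + 1 = m
  · rw [if_neg (by omega), if_pos (by omega), if_pos h]
    ring
  · rw [if_neg (show ¬ (i : ℕ) = m - 1 by omega), if_neg h]
    ring
end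

section
/- Let n ≥ 1 and α ≠ 0 be real, and let A be the n×n real upper shift matrix. Then the linear map on ℝ^{n×n} defined by P ↦ α P + Aᵀ P + P A is bijective; in particular, for any matrix S ∈ ℝ^{n×n} the linear matrix equation α P + Aᵀ P + P A = S has a unique solution P, and if S is symmetric this unique solution is symmetric. -/
open Matrix

theorem shiftMat_pow_apply_eq_zero {n : ℕ} (k : ℕ) {i j : Fin n} (h : (j : ℕ) < i + k) :
    (shiftMat n ^ k) i j = 0 := by
  induction k generalizing j with
  | zero => exact Matrix.one_apply_ne (by rintro rfl; simp at h)
  | succ k ih =>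
    rw [pow_succ, Matrix.mul_apply]
    refine Finset.sum_eq_zero fun l _ => ?_
    by_cases hl : (l : ℕ) < i + k
    · rw [ih hl, zero_mul]
    · have hj : (j : ℕ) ≠ l + 1 := by omega
      simp [shiftMat, hj]

theorem isNilpotent_shiftMat (n : ℕ) : IsNilpotent (shiftMat n) :=
  ⟨n, by ext i j; exact shiftMat_pow_apply_eq_zero n (by omega)⟩

/-- If `a` and `b` are nilpotent and `α ≠ 0`, then `x ↦ α x + a x + x b` is bijective. -/
theorem bijective_smul_add_mul_add_mul {K R : Type*} [Field K] [Ring R] [Algebra K R]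
    {a b : R} (ha : IsNilpotent a) (hb : IsNilpotent b) {α : K} (hα : α ≠ 0) :
    Function.Bijective (fun x : R => α • x + a * x + x * b) := by
  have hnil : IsNilpotent (LinearMap.mulLeft K a + LinearMap.mulRight K b) :=
    (LinearMap.commute_mulLeft_right a b).isNilpotent_add
      ((LinearMap.isNilpotent_mulLeft_iff K a).2 ha)
      ((LinearMap.isNilpotent_mulRight_iff K b).2 hb)
  have hu : IsUnit (algebraMap K (Module.End K R) α) :=
    (IsUnit.mk0 α hα).map (algebraMap K (Module.End K R))
  have hsum := hnil.isUnit_add_left_of_commute hu (Algebra.commutes α _).symm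
  convert (Module.End.isUnit_iff _).1 hsum using 1
  ext x
  simp [add_assoc]

/-- For `α ≠ 0` the map `P ↦ α P + Aᵀ P + P A` is bijective; for every `S` the equation
`α P + Aᵀ P + P A = S` has a unique solution, which is symmetric whenever `S` is. -/
theorem lyapunov_operator_bijective (n : ℕ) (hn : 1 ≤ n) (α : ℝ) (hα : α ≠ 0) :
    Function.Bijective
      (fun P : Matrix (Fin n) (Fin n) ℝ => α • P + (shiftMat n)ᵀ * P + P * shiftMat n)
    ∧ ∀ S : Matrix (Fin n) (Fin n) ℝ,
        (∃! P : Matrix (Fin n) (Fin n) ℝ,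
            α • P + (shiftMat n)ᵀ * P + P * shiftMat n = S)
        ∧ (S.IsSymm → ∀ P : Matrix (Fin n) (Fin n) ℝ,
            α • P + (shiftMat n)ᵀ * P + P * shiftMat n = S → P.IsSymm) := by
  have hbij := bijective_smul_add_mul_add_mul
    ((Matrix.isNilpotent_transpose_iff (A := shiftMat n)).2 (isNilpotent_shiftMat n))
    (isNilpotent_shiftMat n) hα
  refine ⟨hbij, fun S => ⟨hbij.existsUnique S, fun hS P hP => hbij.injective ?_⟩⟩
  have hPt := congrArg Matrix.transpose hP
  simp only [Matrix.transpose_add, Matrix.transpose_smul, Matrix.transpose_mul,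
    Matrix.transpose_transpose, hS.eq] at hPt
  change α • Pᵀ + (shiftMat n)ᵀ * Pᵀ + Pᵀ * shiftMat n = _
  rw [hP, ← hPt, add_right_comm]
end

section
/- Let n ≥ 1 and let α > 0 be real. Then every complex root z of the polynomial zⁿ + (z + α)ⁿ has real part Re z = −α/2. -/
/-- Every complex root `z` of `zⁿ + (z + α)ⁿ` (for `n ≥ 1`, `α > 0`) has
real part `Re z = -α/2`. -/
theorem roots_half_gain_poly_re (n : ℕ) (hn : 1 ≤ n) (α : ℝ) (hα : 0 < α) :
    ∀ z : ℂ, z ^ n + (z + (α : ℂ)) ^ n = 0 → z.re = -α / 2 := by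
  intro z hz
  have hpow : ‖z‖ ^ n = ‖z + (α : ℂ)‖ ^ n := by
    rw [← norm_pow, ← norm_pow, eq_neg_of_add_eq_zero_left hz, norm_neg]
  have hnorm : ‖z‖ = ‖z + (α : ℂ)‖ :=
    (pow_left_inj₀ (norm_nonneg _) (norm_nonneg _) (by omega)).1 hpow
  have hsq : Complex.normSq z = Complex.normSq (z + (α : ℂ)) := by
    rw [Complex.normSq_eq_norm_sq, Complex.normSq_eq_norm_sq, hnorm]
  simp only [Complex.normSq_apply, Complex.add_re, Complex.add_im, Complex.ofReal_re,
    Complex.ofReal_im, add_zero] at hsq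
  have hfactor : α * (2 * z.re + α) = 0 := by linarith
  have hzero := (mul_eq_zero.1 hfactor).resolve_left hα.ne'
  linarith
end
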